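/- Let M ∈ 𝓛𝓒. Then the following are equivalent: (i) lim sup_{t→∞} ω_M(t²)/ω_M(t) < ∞; (ii) there exist C, H > 0 such that ω_M(t²) ≤ C·ω_M(H·t) + C for all t ≥ 0; (iii) there exist k ∈ ℕ_{>0} and A, B ≥ 1 such that (M_j)^{2k} ≤ A·B^j·M_{kj} for all j ∈ ℕ. -/

import Mathlib

theorem stmt_17 (M : ℕ → ℝ) (ω : ℝ → ℝ)
    (hMpos : ∀ j, 0 < M j) (hM0 : M 0 = 1) (hMnorm : M 0 ≤ M 1)
    (hMlc : ∀ j : ℕ, (M (j+1))^2 ≤ M j * M (j+2))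
    (hMgrow : Filter.Tendsto (fun j : ℕ => (M j) ^ (1/(j:ℝ))) Filter.atTop Filter.atTop)
    (hω : ∀ t : ℝ, 0 < t → ω t = ⨆ j : ℕ, Real.log (t^j / M j)) (hω0 : ω 0 = 0) :
    ((Filter.IsBoundedUnder (· ≤ ·) Filter.atTop (fun t : ℝ => ω (t^2) / ω t)) ↔
      (∃ C > (0:ℝ), ∃ H > (0:ℝ), ∀ t ≥ (0:ℝ), ω (t^2) ≤ C * ω (H * t) + C)) ∧
    ((Filter.IsBoundedUnder (· ≤ ·) Filter.atTop (fun t : ℝ => ω (t^2) / ω t)) ↔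
      (∃ k : ℕ, 0 < k ∧ ∃ A B : ℝ, 1 ≤ A ∧ 1 ≤ B ∧
        ∀ j : ℕ, (M j)^(2*k) ≤ A * B^j * M (k*j))) := by
  -- quotients
  obtain ⟨q, hq⟩ : ∃ q : ℕ → ℝ, ∀ j, q j = M (j+1) / M j := ⟨_, fun j => rfl⟩
  have hqM : ∀ j, M (j+1) = q j * M j := fun j => by
    rw [hq, div_mul_cancel₀ _ (hMpos j).ne']
  have hqpos : ∀ j, 0 < q j := fun j => by rw [hq]; exact div_pos (hMpos _) (hMpos _)
  have hqmono : Monotone q := by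
    refine monotone_nat_of_le_succ fun j => ?_
    rw [hq, hq, div_le_div_iff₀ (hMpos _) (hMpos _)]
    have := hMlc j
    nlinarith
  have hq0 : 1 ≤ q 0 := by rw [hq, hM0, div_one, ← hM0]; exact hMnorm
  have hq1 : ∀ j, 1 ≤ q j := fun j => hq0.trans (hqmono (Nat.zero_le j))
  have hMmono : Monotone M := by
    refine monotone_nat_of_le_succ fun j => ?_
    rw [hqM]
    nlinarith [hMpos j, hq1 j]
  have hM1 : ∀ j, 1 ≤ M j := fun j => by rw [← hM0]; exact hMmono (Nat.zero_le j)
  have hMadd : ∀ a b, M a * M b ≤ M (a+b) := by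
    intro a b
    induction b with
    | zero => simp [hM0]
    | succ b ih =>
      rw [← add_assoc, hqM (a+b), hqM b]
      calc M a * (q b * M b) = q b * (M a * M b) := by ring
        _ ≤ q (a+b) * M (a+b) :=
          mul_le_mul (hqmono (by omega)) ih (mul_pos (hMpos a) (hMpos b)).le (hqpos _).le
  have hatt : ∀ m i, (q m)^i * M m ≤ (q m)^m * M i := by
    intro m i
    rcases le_total m i with h | h
    · induction i, h using Nat.le_induction with
      | base => exact le_rfl
      | succ i hi ih =>
        rw [hqM i, pow_succ]
        calc q m ^ i * q m * M m = q m * (q m ^ i * M m) := by ring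
          _ ≤ q i * (q m ^ m * M i) := mul_le_mul (hqmono hi) ih
              (mul_pos (pow_pos (hqpos _) _) (hMpos _)).le (hqpos _).le
          _ = _ := by ring
    · obtain ⟨d, hd⟩ := Nat.exists_eq_add_of_le h
      have key : ∀ d i, i + d = m → (q m)^i * M m ≤ (q m)^m * M i := by
        intro d
        induction d with
        | zero => intro i hi; simp at hi; rw [hi]
        | succ d ih =>
          intro i hi
          have h1 := ih (i+1) (by omega)
          rw [hqM i, pow_succ] at h1
          have h2 : q i ≤ q m := hqmono (by omega)
          have h3 : 0 < q m ^ m * M i := mul_pos (pow_pos (hqpos _) _) (hMpos _)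
          refine le_of_mul_le_mul_left ?_ (hqpos m)
          nlinarith
      exact key d i hd.symm
  have hbdd : ∀ t : ℝ, 0 < t → BddAbove (Set.range fun j : ℕ => Real.log (t^j / M j)) := by
    intro t ht
    apply Filter.IsBoundedUnder.bddAbove_range
    refine ⟨0, ?_⟩
    rw [Filter.eventually_map]
    filter_upwards [hMgrow.eventually_ge_atTop t, Filter.eventually_gt_atTop 0] with j hj hj0
    have h1 : t^j ≤ M j := by
      calc t^j ≤ (M j ^ (1/(j:ℝ)))^j := pow_le_pow_left₀ ht.le hj j
        _ = M j := by
          rw [one_div, Real.rpow_inv_natCast_pow (hMpos j).le (by omega)]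
    exact Real.log_nonpos (div_pos (pow_pos ht _) (hMpos _)).le ((div_le_one (hMpos j)).2 h1)
  have hle : ∀ t : ℝ, 0 < t → ∀ j : ℕ, Real.log (t^j / M j) ≤ ω t := by
    intro t ht j
    rw [hω t ht]
    exact le_ciSup (hbdd t ht) j
  have hge : ∀ t : ℝ, 0 < t → ∀ c, (∀ j : ℕ, Real.log (t^j / M j) ≤ c) → ω t ≤ c := by
    intro t ht c h
    rw [hω t ht]
    exact ciSup_le h
  have hlog : ∀ t : ℝ, 0 < t → ∀ j : ℕ,
      Real.log (t^j / M j) = j * Real.log t - Real.log (M j) := by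
    intro t ht j
    rw [Real.log_div (pow_pos ht j).ne' (hMpos j).ne', Real.log_pow]
  have hnn : ∀ t : ℝ, 0 ≤ t → 0 ≤ ω t := by
    intro t ht
    rcases ht.eq_or_lt with rfl | ht
    · rw [hω0]
    · have := hle t ht 0
      simpa [hM0] using this
  have hmono : ∀ s t : ℝ, 0 ≤ s → s ≤ t → ω s ≤ ω t := by
    intro s t hs hst
    rcases hs.eq_or_lt with rfl | hs
    · rw [hω0]; exact hnn t hst
    · have ht := hs.trans_le hst
      refine hge s hs _ fun j => le_trans ?_ (hle t ht j)
      rw [hlog s hs, hlog t ht]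
      have := Real.log_le_log hs hst
      have := mul_le_mul_of_nonneg_left this (Nat.cast_nonneg (α := ℝ) j)
      linarith
  have hsmall : ∀ t : ℝ, 0 ≤ t → t ≤ 1 → ω t ≤ 0 := by
    intro t ht ht1
    rcases ht.eq_or_lt with rfl | ht
    · rw [hω0]
    · refine hge t ht _ fun j => ?_
      refine Real.log_nonpos (div_pos (pow_pos ht _) (hMpos _)).le ((div_le_one (hMpos j)).2 ?_)
      exact (pow_le_one₀ ht.le ht1).trans (hM1 j)
  have hlogω : ∀ t : ℝ, 0 < t → Real.log t ≤ ω (M 1 * t) := by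
    intro t ht
    have := hle (M 1 * t) (mul_pos (hMpos 1) ht) 1
    rwa [pow_one, mul_div_cancel_left₀ _ (hMpos 1).ne'] at this
  have hωtop : ∀ᶠ t in Filter.atTop, 1 ≤ ω t := by
    filter_upwards [Filter.eventually_ge_atTop (M 1 * Real.exp 1)] with t ht
    have h1 := hlogω (Real.exp 1) (Real.exp_pos 1)
    rw [Real.log_exp] at h1
    exact h1.trans (hmono _ _ (mul_pos (hMpos 1) (Real.exp_pos 1)).le ht)
  have h12 : ((Filter.IsBoundedUnder (· ≤ ·) Filter.atTop (fun t : ℝ => ω (t^2) / ω t)) ↔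
      (∃ C > (0:ℝ), ∃ H > (0:ℝ), ∀ t ≥ (0:ℝ), ω (t^2) ≤ C * ω (H * t) + C)) := by
    constructor
    · rintro ⟨b, hb⟩
      rw [Filter.eventually_map] at hb
      obtain ⟨T, hT⟩ := Filter.eventually_atTop.1 (hb.and hωtop)
      refine ⟨max 1 (max b (ω (T^2))), by positivity, 1, one_pos, fun t ht => ?_⟩
      rw [one_mul]
      set C := max 1 (max b (ω (T^2)))
      have hC1 : 1 ≤ C := le_max_left _ _
      have hCb : b ≤ C := (le_max_left _ _).trans (le_max_right _ _)
      have hCT : ω (T^2) ≤ C := (le_max_right _ _).trans (le_max_right _ _)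
      have h0 := hnn t ht
      rcases le_total T t with h | h
      · obtain ⟨h1, h2⟩ := hT t h
        rw [div_le_iff₀ (by linarith)] at h1
        nlinarith
      · have := hmono (t^2) (T^2) (by positivity) (pow_le_pow_left₀ ht h 2)
        nlinarith
    · rintro ⟨C, hC, H, hH, h⟩
      refine ⟨C*(C+C)+C, ?_⟩
      rw [Filter.eventually_map]
      filter_upwards [hωtop, Filter.eventually_ge_atTop (H^3), Filter.eventually_gt_atTop 0]
        with t h1 h2 h3
      rw [div_le_iff₀ (by linarith)]
      have e1 := h t h3.le
      have e2 := h (Real.sqrt (H*t)) (Real.sqrt_nonneg _)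
      rw [Real.sq_sqrt (by positivity)] at e2
      have e3 : H * Real.sqrt (H*t) ≤ t := by
        refine abs_le_of_sq_le_sq' ?_ h3.le |>.2
        rw [mul_pow, Real.sq_sqrt (by positivity)]
        nlinarith
      have e4 := hmono _ _ (by positivity) e3
      calc ω (t^2) ≤ C * ω (H*t) + C := e1
        _ ≤ C * (C * ω t + C) + C := by gcongr; exact e2.trans (by gcongr)
        _ ≤ C * (C * ω t + C * ω t) + C * ω t := by gcongr <;> nlinarith
        _ = _ := by ring
  refine ⟨h12, h12.trans ?_⟩
  constructor
  · rintro ⟨C, hC, H, hH, h⟩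
    obtain ⟨k, hk⟩ := exists_nat_ge C
    have hk0 : 0 < k := by
      have : (0:ℝ) < k := hC.trans_le hk
      exact_mod_cast this
    obtain ⟨G, hG1, hGH⟩ : ∃ G : ℝ, 1 ≤ G ∧ H ≤ G := ⟨max 1 H, le_max_left _ _, le_max_right _ _⟩
    have hG0 : 0 < G := by linarith
    refine ⟨k, hk0, Real.exp k, G^(2*k), Real.one_le_exp (by positivity), one_le_pow₀ hG1,
      fun j => ?_⟩
    -- choose t with G t = q (2j)
    have hq := hqpos (2*j)
    set t := q (2*j) / G with ht
    have ht0 : 0 < t := div_pos hq hG0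
    have hGt : G * t = q (2*j) := by rw [ht]; field_simp
    have e1 : ω (t^2) ≤ k * ω (q (2*j)) + k := by
      have a := h t ht0.le
      have b := hmono (H*t) (q (2*j)) (by positivity) (by rw [← hGt]; gcongr)
      have c := hnn (H*t) (by positivity)
      calc ω (t^2) ≤ C * ω (H*t) + C := a
        _ ≤ k * ω (q (2*j)) + k := by gcongr
    have e2 : ω (q (2*j)) ≤ (2*j:ℕ) * Real.log (q (2*j)) - Real.log (M (2*j)) := by
      refine hge _ hq _ fun i => ?_
      rw [← hlog _ hq]
      refine Real.log_le_log (div_pos (pow_pos hq _) (hMpos _)) ?_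
      rw [div_le_div_iff₀ (hMpos _) (hMpos _)]
      exact hatt _ _
    have e3 := hle (t^2) (by positivity) (k*j)
    rw [hlog _ (by positivity), Real.log_pow] at e3
    have e4 : Real.log (q (2*j)) = Real.log G + Real.log t := by
      rw [← hGt, Real.log_mul hG0.ne' ht0.ne']
    have e5 : 2 * Real.log (M j) ≤ Real.log (M (2*j)) := by
      have := Real.log_le_log (mul_pos (hMpos j) (hMpos j)) (hMadd j j)
      rw [Real.log_mul (hMpos j).ne' (hMpos j).ne', ← two_mul, ← two_mul] at this
      exact this
    rw [← Real.log_le_log_iff (pow_pos (hMpos j) _) (by have := hMpos (k*j); positivity),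
      Real.log_mul (by positivity) (hMpos _).ne', Real.log_mul (by positivity) (by positivity),
      Real.log_exp, Real.log_pow, Real.log_pow, Real.log_pow]
    push_cast at *
    have hk' : (0:ℝ) ≤ k := by positivity
    have e6 := mul_le_mul_of_nonneg_left e2 hk'
    have e7 := mul_le_mul_of_nonneg_left e5 hk'
    rw [e4] at e6
    nlinarith
  · rintro ⟨k, hk, A, B, hA, hB, h⟩
    have hlA := Real.log_nonneg hA
    have hlB := Real.log_nonneg hB
    have hkR : (1:ℝ) ≤ k := by exact_mod_cast hk
    obtain ⟨H, hHB, hHM⟩ : ∃ H : ℝ, B ≤ H ∧ M 1 ≤ H := ⟨max B (M 1), le_max_left _ _, le_max_right _ _⟩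
    have hH0 : 0 < H := by linarith
    refine ⟨4*k + Real.log A, by positivity, H, hH0, fun t ht => ?_⟩
    have hn := hnn (H*t) (by positivity)
    rcases le_total t 1 with h1 | h1
    · have := hsmall (t^2) (by positivity) (pow_le_one₀ ht h1)
      have : 0 ≤ (4*k + Real.log A) * ω (H*t) + (4*k + Real.log A) := by positivity
      linarith
    · have ht0 : 0 < t := by linarith
      have hlt := Real.log_nonneg h1
      suffices hs : ω (t^2) ≤ 4*k*ω (H*t) + Real.log A by nlinarith [mul_nonneg hlA hn]
      have hl1 : Real.log t ≤ ω (H*t) := (hlogω t ht0).trans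
        (hmono _ _ (mul_pos (hMpos 1) ht0).le (by gcongr))
      refine hge _ (by positivity) _ fun n => ?_
      rw [hlog _ (by positivity), Real.log_pow]
      have hdm := Nat.div_add_mod n k
      have hml := Nat.mod_lt n hk
      set j := n / k
      have hn1 : (n:ℝ) ≤ k * j + k := by
        have : n ≤ k * j + k := by omega
        exact_mod_cast this
      have hMn : Real.log (M (k*j)) ≤ Real.log (M n) :=
        Real.log_le_log (hMpos _) (hMmono (by omega))
      have hj := Real.log_le_log (pow_pos (hMpos j) _) (h j)
      rw [Real.log_mul (by positivity) (hMpos _).ne', Real.log_mul (by positivity) (by positivity),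
        Real.log_pow, Real.log_pow] at hj
      have hHt := hle (B*t) (by positivity) j
      rw [hlog _ (by positivity), Real.log_mul (by positivity) (by positivity)] at hHt
      have hHt2 := hHt.trans (hmono (B*t) (H*t) (by positivity) (by gcongr))
      push_cast at *
      have a1 := mul_le_mul_of_nonneg_right hn1 hlt
      have a2 := mul_le_mul_of_nonneg_left hHt2 (by positivity : (0:ℝ) ≤ 2*k)
      have a3 := mul_le_mul_of_nonneg_left hl1 (by positivity : (0:ℝ) ≤ 2*k)
      have a4 : (j:ℝ) * Real.log B ≤ 2*k*(j * Real.log B) := by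
        have : 0 ≤ (j:ℝ) * Real.log B := by positivity
        nlinarith
      nlinarith
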